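/- Let s : U → W, t : U → V, f : W → X, g : V → X be chain maps of chain complexes of ℚ-vector spaces forming a commutative square, f ∘ s = g ∘ t. Then α : U → 𝒫(f,g) given degreewise by α(u) = (s(u), 0, −t(u)) is a chain map, β : 𝒞(s,t) → X given degreewise by β(w, u, v) = f(w) − g(v) is a chain map, and α is a quasi-isomorphism if and only if β is a quasi-isomorphism. (A commutative square of rational chain complexes is homotopy cartesian if and only if it is homotopy cocartesian.) -/

import Mathlib

set_option autoImplicit false

/-- A `ℤ`-indexed graded `ℚ`-vector space equipped with a degree `-1` linear map
(the underlying data of a chain complex). -/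
structure PreDG where
  V : ℤ → Type
  [grp : ∀ n, AddCommGroup (V n)]
  [mod : ∀ n, Module ℚ (V n)]
  d : ∀ n : ℤ, V n →ₗ[ℚ] V (n - 1)

attribute [instance] PreDG.grp PreDG.mod

/-- A chain complex of `ℚ`-vector spaces: the differential squares to zero. -/
structure DG extends PreDG where
  dd : ∀ (n : ℤ) (x : V n), d (n - 1) (d n x) = 0

namespace PreDG

/-- Transport along an equality of degrees. -/
def castV (A : PreDG) : ∀ {m n : ℤ}, m = n → (A.V m →ₗ[ℚ] A.V n)
  | _, _, rfl => LinearMap.id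

/-- A chain map: a family of degree-0 linear maps commuting with the differentials. -/
structure Hom (A B : PreDG) where
  f : ∀ n : ℤ, A.V n →ₗ[ℚ] B.V n
  comm : ∀ (n : ℤ) (x : A.V n), f (n - 1) (A.d n x) = B.d n (f n x)

theorem Hom.cast_comm {A B : PreDG} (φ : Hom A B) {m n : ℤ} (h : m = n) (x : A.V m) :
    φ.f n (A.castV h x) = B.castV h (φ.f m x) := by subst h; rfl

/-- The cycles in degree `n`. -/
def cycles (A : PreDG) (n : ℤ) : Submodule ℚ (A.V n) :=
  LinearMap.ker (A.d n)

/-- The boundaries in degree `n`. -/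
def boundaries (A : PreDG) (n : ℤ) : Submodule ℚ (A.V n) :=
  LinearMap.range ((A.castV (show n + 1 - 1 = n by omega)).comp (A.d (n + 1)))

/-- The homology in degree `n`: cycles modulo boundaries. -/
abbrev homology (A : PreDG) (n : ℤ) :=
  A.cycles n ⧸ ((A.boundaries n).comap (A.cycles n).subtype)

/-- A chain map sends cycles to cycles. -/
def Hom.cyclesMap {A B : PreDG} (φ : Hom A B) (n : ℤ) :
    A.cycles n →ₗ[ℚ] B.cycles n :=
  (φ.f n).restrict (fun x hx => by
    have hx' : A.d n x = 0 := hx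
    show B.d n (φ.f n x) = 0
    rw [← φ.comm n x, hx', map_zero])

/-- The map induced on homology by a chain map. -/
def Hom.homologyMap {A B : PreDG} (φ : Hom A B) (n : ℤ) :
    A.homology n →ₗ[ℚ] B.homology n :=
  Submodule.mapQ _ _ (φ.cyclesMap n) (by
    rintro ⟨x, hxc⟩ hx
    simp only [Submodule.mem_comap, Submodule.subtype_apply, boundaries,
      LinearMap.mem_range, LinearMap.coe_comp, Function.comp_apply] at hx ⊢
    obtain ⟨y, hy⟩ := hx
    refine ⟨φ.f (n + 1) y, ?_⟩
    have hcoe : ((φ.cyclesMap n ⟨x, hxc⟩ : B.cycles n) : B.V n) = φ.f n x := rfl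
    rw [hcoe, ← φ.comm (n + 1) y, ← φ.cast_comm, hy])

/-- A chain map is a quasi-isomorphism if it induces an isomorphism on homology in every
degree. -/
def Hom.QuasiIso {A B : PreDG} (φ : Hom A B) : Prop :=
  ∀ n : ℤ, Function.Bijective (φ.homologyMap n)

/-- The `n`-th term of the path complex `𝒫(f,g)` of a cospan `f : A → B ← C : g`:
`A_n × B_{n+1} × C_n`. -/
abbrev pathV (A B C : PreDG) (n : ℤ) : Type := A.V n × B.V (n + 1) × C.V n

/-- The differential of the path complex `𝒫(f,g)`:
`d (u, v, w) = (d_A u, f u + g w - d_B v, d_C w)`. -/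
def pathD (A B C : PreDG) (f : ∀ n : ℤ, A.V n →ₗ[ℚ] B.V n)
    (g : ∀ n : ℤ, C.V n →ₗ[ℚ] B.V n) (n : ℤ) :
    pathV A B C n →ₗ[ℚ] pathV A B C (n - 1) :=
  LinearMap.prod
    ((A.d n).comp (LinearMap.fst ℚ (A.V n) (B.V (n + 1) × C.V n)))
    (LinearMap.prod
      ((B.castV (show n = n - 1 + 1 by omega)).comp
          ((f n).comp (LinearMap.fst ℚ (A.V n) (B.V (n + 1) × C.V n))
            + (g n).comp ((LinearMap.snd ℚ (B.V (n + 1)) (C.V n)).comp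
                (LinearMap.snd ℚ (A.V n) (B.V (n + 1) × C.V n))))
        - (B.castV (show n + 1 - 1 = n - 1 + 1 by omega)).comp
            ((B.d (n + 1)).comp ((LinearMap.fst ℚ (B.V (n + 1)) (C.V n)).comp
                (LinearMap.snd ℚ (A.V n) (B.V (n + 1) × C.V n)))))
      ((C.d n).comp ((LinearMap.snd ℚ (B.V (n + 1)) (C.V n)).comp
          (LinearMap.snd ℚ (A.V n) (B.V (n + 1) × C.V n)))))

/-- The path-complex differential is given by the formula
`d (u, v, w) = (d_A u, f u + g w - d_B v, d_C w)` (up to transport of degrees). -/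
theorem pathD_apply (A B C : PreDG) (f : ∀ n : ℤ, A.V n →ₗ[ℚ] B.V n)
    (g : ∀ n : ℤ, C.V n →ₗ[ℚ] B.V n) (n : ℤ) (u : A.V n) (v : B.V (n + 1)) (w : C.V n) :
    pathD A B C f g n (u, v, w)
      = (A.d n u,
         B.castV (show n = n - 1 + 1 by omega) (f n u + g n w)
           - B.castV (show n + 1 - 1 = n - 1 + 1 by omega) (B.d (n + 1) v),
         C.d n w) := rfl

/-- The path complex `𝒫(f,g)` (as a graded vector space with degree `-1` map). -/
def pathPre (A B C : PreDG) (f : ∀ n : ℤ, A.V n →ₗ[ℚ] B.V n)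
    (g : ∀ n : ℤ, C.V n →ₗ[ℚ] B.V n) : PreDG where
  V := pathV A B C
  grp := fun _ => inferInstance
  mod := fun _ => inferInstance
  d := pathD A B C f g

/-- The `n`-th term of the cylinder complex `𝒞(f,g)` of a span `f : A ← B → C : g`:
`A_n ⊕ B_{n-1} ⊕ C_n`. -/
abbrev cylV (A B C : PreDG) (n : ℤ) : Type := A.V n × B.V (n - 1) × C.V n

/-- The differential of the cylinder complex `𝒞(f,g)`:
`d (u, v, w) = (d_A u + f v, -d_B v, d_C w + g v)`. -/
def cylD (A B C : PreDG) (f : ∀ n : ℤ, B.V n →ₗ[ℚ] A.V n)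
    (g : ∀ n : ℤ, B.V n →ₗ[ℚ] C.V n) (n : ℤ) :
    cylV A B C n →ₗ[ℚ] cylV A B C (n - 1) :=
  LinearMap.prod
    ((A.d n).comp (LinearMap.fst ℚ (A.V n) (B.V (n - 1) × C.V n))
      + (f (n - 1)).comp ((LinearMap.fst ℚ (B.V (n - 1)) (C.V n)).comp
          (LinearMap.snd ℚ (A.V n) (B.V (n - 1) × C.V n))))
    (LinearMap.prod
      (-((B.d (n - 1)).comp ((LinearMap.fst ℚ (B.V (n - 1)) (C.V n)).comp
          (LinearMap.snd ℚ (A.V n) (B.V (n - 1) × C.V n)))))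
      ((C.d n).comp ((LinearMap.snd ℚ (B.V (n - 1)) (C.V n)).comp
          (LinearMap.snd ℚ (A.V n) (B.V (n - 1) × C.V n)))
        + (g (n - 1)).comp ((LinearMap.fst ℚ (B.V (n - 1)) (C.V n)).comp
            (LinearMap.snd ℚ (A.V n) (B.V (n - 1) × C.V n)))))

/-- The cylinder-complex differential is given by the formula
`d (u, v, w) = (d_A u + f v, -d_B v, d_C w + g v)`. -/
theorem cylD_apply (A B C : PreDG) (f : ∀ n : ℤ, B.V n →ₗ[ℚ] A.V n)
    (g : ∀ n : ℤ, B.V n →ₗ[ℚ] C.V n) (n : ℤ) (u : A.V n) (v : B.V (n - 1)) (w : C.V n) :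
    cylD A B C f g n (u, v, w)
      = (A.d n u + f (n - 1) v, -(B.d (n - 1) v), C.d n w + g (n - 1) v) := rfl

/-- The cylinder complex `𝒞(f,g)` (as a graded vector space with degree `-1` map). -/
def cylPre (A B C : PreDG) (f : ∀ n : ℤ, B.V n →ₗ[ℚ] A.V n)
    (g : ∀ n : ℤ, B.V n →ₗ[ℚ] C.V n) : PreDG where
  V := cylV A B C
  grp := fun _ => inferInstance
  mod := fun _ => inferInstance
  d := cylD A B C f g

end PreDG

open PreDG

namespace PreDG

/-- The differential between degrees related by an equation. -/
def dh (A : PreDG) {m n : ℤ} (h : m - 1 = n) : A.V m →ₗ[ℚ] A.V n :=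
  (A.castV h).comp (A.d m)

theorem dh_self (A : PreDG) (m : ℤ) (x : A.V m) : A.dh (rfl : m - 1 = m - 1) x = A.d m x := rfl

theorem castV_self (A : PreDG) {m : ℤ} (h : m = m) (x : A.V m) : A.castV h x = x := rfl

theorem castV_castV (A : PreDG) {m n k : ℤ} (h : m = n) (h' : n = k) (x : A.V m) :
    A.castV h' (A.castV h x) = A.castV (h.trans h') x := by subst h; subst h'; rfl

theorem castV_d (A : PreDG) {m n k : ℤ} (h : m = n) (h' : m - 1 = k) (h'' : n - 1 = k)
    (x : A.V m) : A.dh h'' (A.castV h x) = A.castV h' (A.d m x) := by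
  subst h; rfl

theorem castV_eq_zero (A : PreDG) {m n : ℤ} (h : m = n) (x : A.V m) :
    A.castV h x = 0 ↔ x = 0 := by subst h; rfl

theorem Hom.dh_comm {A B : PreDG} (φ : Hom A B) {m n : ℤ} (h : m - 1 = n) (x : A.V m) :
    φ.f n (A.dh h x) = B.dh h (φ.f m x) := by subst h; exact φ.comm m x

theorem dh_eq_zero (A : PreDG) {m n : ℤ} (h : m - 1 = n) (x : A.V m) :
    A.dh h x = 0 ↔ A.d m x = 0 := by subst h; rfl

/-- Acyclicity of the mapping cone. -/
def Hom.ConeAcyclic {A B : PreDG} (φ : Hom A B) : Prop :=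
  ∀ (n : ℤ) (a : A.V n) (b : B.V (n + 1)), A.d n a = 0 →
    B.dh (show n + 1 - 1 = n by omega) b = φ.f n a →
    ∃ (a' : A.V (n + 1)) (b' : B.V (n + 1 + 1)),
      A.dh (show n + 1 - 1 = n by omega) a' = a ∧
      φ.f (n + 1) a' + B.dh (show n + 1 + 1 - 1 = n + 1 by omega) b' = b

theorem Hom.homologyMap_inj {A B : PreDG} (φ : Hom A B) (n : ℤ) :
    Function.Injective (φ.homologyMap n) ↔
      ∀ (a : A.V n) (b : B.V (n + 1)), A.d n a = 0 →
        B.dh (show n + 1 - 1 = n by omega) b = φ.f n a →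
        ∃ a' : A.V (n + 1), A.dh (show n + 1 - 1 = n by omega) a' = a := by
  rw [injective_iff_map_eq_zero]
  constructor
  · intro h a b ha hb
    have := h (Submodule.Quotient.mk ⟨a, ha⟩) (by
      refine (Submodule.Quotient.mk_eq_zero _).2 ?_
      exact ⟨b, hb⟩)
    exact (Submodule.Quotient.mk_eq_zero _).1 this
  · intro h x hx
    obtain ⟨⟨a, ha⟩, rfl⟩ := Submodule.Quotient.mk_surjective _ x
    obtain ⟨b, hb⟩ := (Submodule.Quotient.mk_eq_zero _).1 hx
    exact (Submodule.Quotient.mk_eq_zero _).2 (h a b ha hb)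

theorem Hom.homologyMap_surj {A B : PreDG} (φ : Hom A B) (n : ℤ) :
    Function.Surjective (φ.homologyMap n) ↔
      ∀ (b : B.V n), B.d n b = 0 → ∃ (a' : A.V n) (b' : B.V (n + 1)), A.d n a' = 0 ∧
        φ.f n a' + B.dh (show n + 1 - 1 = n by omega) b' = b := by
  constructor
  · intro h b hb
    obtain ⟨x, hx⟩ := h (Submodule.Quotient.mk ⟨b, hb⟩)
    obtain ⟨⟨a, ha⟩, rfl⟩ := Submodule.Quotient.mk_surjective _ x
    obtain ⟨b', hb'⟩ := (Submodule.Quotient.eq _).1 hx.symm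
    have hb'' : B.dh (show n + 1 - 1 = n by omega) b' = b - φ.f n a := hb'
    exact ⟨a, b', ha, by rw [hb'']; abel⟩
  · intro h y
    obtain ⟨⟨b, hb⟩, rfl⟩ := Submodule.Quotient.mk_surjective _ y
    obtain ⟨a, b', ha, hb'⟩ := h b hb
    refine ⟨Submodule.Quotient.mk ⟨a, ha⟩, Eq.symm ?_⟩
    refine (Submodule.Quotient.eq _).2 ⟨b', ?_⟩
    change B.dh (show n + 1 - 1 = n by omega) b' = b - φ.f n a
    rw [← hb']; abel

theorem Hom.quasiIso_iff {A B : PreDG} (φ : Hom A B) : φ.QuasiIso ↔ φ.ConeAcyclic := by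
  constructor
  · intro h n a b ha hb
    obtain ⟨a0, ha0⟩ := (φ.homologyMap_inj n).1 (h n).1 a b ha hb
    obtain ⟨a1, b', ha1, hb'⟩ := (φ.homologyMap_surj (n + 1)).1 (h (n + 1)).2
      (b - φ.f (n + 1) a0) (by
        rw [← dh_eq_zero B (show n + 1 - 1 = n by omega), map_sub, hb, ← φ.dh_comm, ha0, sub_self])
    refine ⟨a0 + a1, b', ?_, ?_⟩
    · rw [map_add, ha0, (dh_eq_zero A _ a1).2 ha1, add_zero]
    · rw [map_add, add_assoc, hb']; abel
  · intro h n
    constructor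
    · rw [φ.homologyMap_inj]
      intro a b ha hb
      obtain ⟨a', b', h1, h2⟩ := h n a b ha hb
      exact ⟨a', h1⟩
    · rw [φ.homologyMap_surj]
      obtain ⟨m, rfl⟩ : ∃ m, n = m + 1 := ⟨n - 1, by omega⟩
      intro b hb
      obtain ⟨a', b', h1, h2⟩ := h m 0 b (map_zero _) (by
        rw [map_zero]; exact (dh_eq_zero B _ b).2 hb)
      exact ⟨a', b', (dh_eq_zero A _ a').1 h1, h2⟩

theorem path_dh (A B C : PreDG) (f : ∀ n : ℤ, A.V n →ₗ[ℚ] B.V n)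
    (g : ∀ n : ℤ, C.V n →ₗ[ℚ] B.V n) {m n : ℤ} (h : m - 1 = n)
    (u : A.V m) (v : B.V (m + 1)) (w : C.V m) :
    (pathPre A B C f g).dh h (u, v, w)
      = (A.dh h u, B.castV (show m = n + 1 by omega) (f m u + g m w)
          - B.dh (show m + 1 - 1 = n + 1 by omega) v, C.dh h w) := by
  subst h; rfl

theorem cyl_dh (A B C : PreDG) (f : ∀ n : ℤ, B.V n →ₗ[ℚ] A.V n)
    (g : ∀ n : ℤ, B.V n →ₗ[ℚ] C.V n) {m n : ℤ} (h : m - 1 = n)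
    (u : A.V m) (v : B.V (m - 1)) (w : C.V m) :
    (cylPre A B C f g).dh h (u, v, w)
      = (A.dh h u + f n (B.castV h v), -(B.dh (show m - 1 - 1 = n - 1 by omega) v),
          C.dh h w + g n (B.castV h v)) := by
  subst h; rfl

/-- The map from the initial corner to the path complex. -/
def alphaHom {U W V X : PreDG} (s : Hom U W) (t : Hom U V) (f : Hom W X) (g : Hom V X)
    (hsq : ∀ (n : ℤ) (x : U.V n), f.f n (s.f n x) = g.f n (t.f n x)) :
    Hom U (pathPre W X V f.f g.f) where
  f := fun n => LinearMap.prod (s.f n) (LinearMap.prod 0 (-(t.f n)))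
  comm := fun n x => by
    change (s.f (n - 1) (U.d n x), (0 : X.V (n - 1 + 1)), -(t.f (n - 1) (U.d n x)))
      = pathD W X V f.f g.f n (s.f n x, 0, -(t.f n x))
    rw [pathD_apply, s.comm, t.comm, map_neg, map_neg, hsq, add_neg_cancel]
    simp only [map_zero, sub_zero]

/-- The map from the cylinder complex to the terminal corner. -/
def betaHom {U W V X : PreDG} (s : Hom U W) (t : Hom U V) (f : Hom W X) (g : Hom V X)
    (hsq : ∀ (n : ℤ) (x : U.V n), f.f n (s.f n x) = g.f n (t.f n x)) :
    Hom (cylPre W U V s.f t.f) X where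
  f := fun n => (f.f n).comp (LinearMap.fst ℚ (W.V n) (U.V (n - 1) × V.V n))
    - (g.f n).comp ((LinearMap.snd ℚ (U.V (n - 1)) (V.V n)).comp
        (LinearMap.snd ℚ (W.V n) (U.V (n - 1) × V.V n)))
  comm := fun n x => by
    obtain ⟨w, u, v⟩ := x
    change f.f (n - 1) (W.d n w + s.f (n - 1) u) - g.f (n - 1) (V.d n v + t.f (n - 1) u)
      = X.d n (f.f n w - g.f n v)
    rw [map_add, map_add, map_sub, hsq, f.comm, g.comm]
    abel

/-- Acyclicity of the total complex of the square. -/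
def SquareAcyclic {U W V X : PreDG} (s : Hom U W) (t : Hom U V) (f : Hom W X) (g : Hom V X) :
    Prop :=
  ∀ (i j k l : ℤ) (hi : j - 1 = i) (hj : k - 1 = j) (hk : l - 1 = k)
    (u : U.V i) (w : W.V j) (v : V.V j) (x : X.V k),
    U.d i u = 0 → W.dh hi w = s.f i u → V.dh hi v = -(t.f i u) →
    X.dh hj x = f.f j w + g.f j v →
    ∃ (u' : U.V j) (w' : W.V k) (v' : V.V k) (x' : X.V l),
      U.dh hi u' = u ∧ s.f j u' + W.dh hj w' = w ∧ -(t.f j u') + V.dh hj v' = v ∧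
      f.f k w' + g.f k v' - X.dh hk x' = x

theorem alpha_cone {U W V X : PreDG} (s : Hom U W) (t : Hom U V) (f : Hom W X) (g : Hom V X)
    (hsq : ∀ (n : ℤ) (x : U.V n), f.f n (s.f n x) = g.f n (t.f n x)) :
    (alphaHom s t f g hsq).ConeAcyclic ↔ SquareAcyclic s t f g := by
  have key : ∀ (n : ℤ) (x : U.V n),
      (alphaHom s t f g hsq).f n x = (s.f n x, (0 : X.V (n + 1)), -(t.f n x)) := fun _ _ => rfl
  constructor
  · intro h i j k l hi hj hk u w v x hu hw hv hx
    obtain rfl : j = i + 1 := by omega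
    obtain rfl : k = i + 1 + 1 := by omega
    obtain rfl : l = i + 1 + 1 + 1 := by omega
    obtain ⟨u', ⟨w', x', v'⟩, h1, h2⟩ := h i u (w, x, v) hu (by
      rw [path_dh, key, hw, hv, hx, castV_self, sub_self])
    rw [path_dh, key, castV_self] at h2
    have e1 := congrArg (fun z : pathV W X V (i + 1) => z.1) h2
    have e2 := congrArg (fun z : pathV W X V (i + 1) => z.2.1) h2
    have e3 := congrArg (fun z : pathV W X V (i + 1) => z.2.2) h2
    exact ⟨u', w', v', x', h1, e1, e3, (zero_add _).symm.trans e2⟩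
  · rintro h i u ⟨w, x, v⟩ hu hb
    rw [path_dh, key, castV_self] at hb
    have e1 := congrArg (fun z : pathV W X V i => z.1) hb
    have e2 := congrArg (fun z : pathV W X V i => z.2.1) hb
    have e3 := congrArg (fun z : pathV W X V i => z.2.2) hb
    obtain ⟨u', w', v', x', h1, h2, h3, h4⟩ := h i (i + 1) (i + 1 + 1) (i + 1 + 1 + 1) (by omega)
      (by omega) (by omega) u w v x hu e1 e3 (sub_eq_zero.1 e2).symm
    refine ⟨u', (w', x', v'), h1, ?_⟩
    rw [path_dh, key, castV_self]
    exact Prod.ext h2 (Prod.ext ((zero_add _).trans h4) h3)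

theorem beta_cone {U W V X : PreDG} (s : Hom U W) (t : Hom U V) (f : Hom W X) (g : Hom V X)
    (hsq : ∀ (n : ℤ) (x : U.V n), f.f n (s.f n x) = g.f n (t.f n x)) :
    (betaHom s t f g hsq).ConeAcyclic ↔ SquareAcyclic s t f g := by
  have key : ∀ (n : ℤ) (w : W.V n) (u : U.V (n - 1)) (v : V.V n),
      (betaHom s t f g hsq).f n (w, u, v) = f.f n w - g.f n v := fun _ _ _ _ => rfl
  constructor
  · intro h i j k l hi hj hk u w v x hu hw hv hx
    obtain rfl : i = j - 1 := by omega
    obtain rfl : k = j + 1 := by omega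
    obtain rfl : l = j + 1 + 1 := by omega
    rw [dh_self] at hw hv
    obtain ⟨⟨w', u', v'⟩, x', h1, h2⟩ := h j (w, -u, -v) x (by
        change cylD W U V s.f t.f j (w, -u, -v) = 0
        rw [cylD_apply]
        simp only [map_neg, hw, hv, hu, neg_zero, neg_neg, add_neg_cancel]
        rfl) (by
        rw [key, hx, map_neg, sub_neg_eq_add])
    rw [cyl_dh] at h1
    rw [key] at h2
    have e1 := congrArg (fun z : cylV W U V j => z.1) h1
    have e2 := congrArg (fun z : cylV W U V j => z.2.1) h1
    have e3 := congrArg (fun z : cylV W U V j => z.2.2) h1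
    dsimp only at e1 e2 e3
    refine ⟨U.castV (by omega) u', w', -v', -x', ?_, ?_, ?_, ?_⟩
    · rw [castV_d _ _ (by omega)]
      exact neg_injective e2
    · rw [← e1, add_comm]
    · rw [map_neg, ← neg_eq_iff_eq_neg.2 e3.symm.symm, neg_add, add_comm]
    · rw [map_neg, map_neg, ← h2]; abel
  · rintro h j ⟨w, u, v⟩ x ha hb
    change cylD W U V s.f t.f j (w, u, v) = 0 at ha
    rw [cylD_apply] at ha
    rw [key] at hb
    have e1 := congrArg (fun z : cylV W U V (j - 1) => z.1) ha
    have e2 := congrArg (fun z : cylV W U V (j - 1) => z.2.1) ha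
    have e3 := congrArg (fun z : cylV W U V (j - 1) => z.2.2) ha
    change W.d j w + s.f (j - 1) u = 0 at e1
    change -(U.d (j - 1) u) = 0 at e2
    change V.d j v + t.f (j - 1) u = 0 at e3
    obtain ⟨u', w', v', x', h1, h2, h3, h4⟩ := h (j - 1) j (j + 1) (j + 1 + 1) rfl
      (by omega) (by omega) (-u) w (-v) x (by rw [map_neg, e2])
      (by rw [dh_self, map_neg]; exact eq_neg_of_add_eq_zero_left e1)
      (by rw [dh_self, map_neg, map_neg, eq_neg_of_add_eq_zero_left e3])
      (by rw [hb, map_neg, sub_eq_add_neg])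
    refine ⟨(w', U.castV (by omega) u', -v'), -x', ?_, ?_⟩
    · rw [cyl_dh, castV_castV, castV_self, castV_d _ _ (by omega)]
      refine Prod.ext ?_ (Prod.ext ?_ ?_)
      · exact (add_comm _ _).trans h2
      · exact neg_eq_iff_eq_neg.2 h1
      · change V.dh _ (-v') + t.f j u' = v
        rw [map_neg, ← neg_injective.eq_iff, ← h3]; abel
    · rw [key, ← h4, map_neg, map_neg]; abel

end PreDG

/-- Let `s : U → W`, `t : U → V`, `f : W → X`, `g : V → X` be chain maps
with `f ∘ s = g ∘ t`.  Then `α : U → 𝒫(f,g)`, `α u = (s u, 0, -t u)`, is a chain map,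
`β : 𝒞(s,t) → X`, `β (w, u, v) = f w - g v`, is a chain map, and `α` is a
quasi-isomorphism if and only if `β` is a quasi-isomorphism (a commutative square of
rational chain complexes is homotopy cartesian iff it is homotopy cocartesian). -/
theorem homotopy_cartesian_iff_homotopy_cocartesian (U W V X : DG)
    (s : Hom U.toPreDG W.toPreDG) (t : Hom U.toPreDG V.toPreDG)
    (f : Hom W.toPreDG X.toPreDG) (g : Hom V.toPreDG X.toPreDG)
    (hsq : ∀ (n : ℤ) (x : U.V n), f.f n (s.f n x) = g.f n (t.f n x)) :
    ∃ (α : Hom U.toPreDG (pathPre W.toPreDG X.toPreDG V.toPreDG f.f g.f))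
      (β : Hom (cylPre W.toPreDG U.toPreDG V.toPreDG s.f t.f) X.toPreDG),
      (∀ (n : ℤ) (x : U.V n), α.f n x = (s.f n x, 0, -(t.f n x))) ∧
      (∀ (n : ℤ) (y : cylV W.toPreDG U.toPreDG V.toPreDG n),
          β.f n y = f.f n y.1 - g.f n y.2.2) ∧
      (α.QuasiIso ↔ β.QuasiIso) := by
  exact ⟨alphaHom s t f g hsq, betaHom s t f g hsq, fun _ _ => rfl, fun _ _ => rfl,
    by rw [Hom.quasiIso_iff, Hom.quasiIso_iff, alpha_cone, beta_cone]⟩
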